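/- Let P be the matroid polytope of the uniform matroid U_{2,n} (the hypersimplex Δ_{2,n}). Then the h*-vector of P is given by h*₀ = 1, h*₁ = C(n,2) − n, and h*_k = C(n, 2k) for every k ≥ 2. -/

import Mathlib

/-!
Statement 17: The `h*`-vector of the hypersimplex `Δ_{2,n}` (the matroid polytope of
`U_{2,n}`) is `h*₀ = 1`, `h*₁ = C(n,2) - n`, and `h*_k = C(n, 2k)` for `k ≥ 2`.
-/

open scoped Pointwise

/-- The 0/1 indicator vector of a subset of `[n]`. -/
def indVec {n : ℕ} (B : Finset (Fin n)) : Fin n → ℝ :=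
  fun i => if i ∈ B then 1 else 0

/-- The matroid polytope of the uniform matroid `U_{2,n}` (the hypersimplex
`Δ_{2,n}`). -/
def hypersimplexTwo (n : ℕ) : Set (Fin n → ℝ) :=
  convexHull ℝ {x | ∃ B : Finset (Fin n), B.card = 2 ∧ x = indVec B}

/-- The number of lattice (integer) points of a subset of `ℝⁿ`. -/
noncomputable def latticeCount {n : ℕ} (S : Set (Fin n → ℝ)) : ℕ :=
  Set.ncard {x ∈ S | ∀ i, ∃ m : ℤ, x i = (m : ℝ)}

/-- `h` is the `h*`-vector of the lattice polytope `P` of dimension `d`: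
`L_P(t) = ∑_{k=0}^{d} h_k · C(t + d - k, d)` for all `t ≥ 0`, and `h` vanishes beyond
degree `d`. -/
def IsHStarVector {n : ℕ} (P : Set (Fin n → ℝ)) (d : ℕ) (h : ℕ → ℕ) : Prop :=
  (∀ t : ℕ, latticeCount ((t : ℝ) • P) =
      ∑ k ∈ Finset.range (d + 1), h k * Nat.choose (t + d - k) d) ∧
  ∀ k, d < k → h k = 0

theorem card_finAntidiagonal_nat {n : ℕ} (hn : 1 ≤ n) (m : ℕ) :
    (Finset.finAntidiagonal n m).card = (m + (n - 1)).choose (n - 1) := by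
  rw [← Nat.subtype_card (p := fun x : Fin n → ℕ => ∑ i, x i = m) _ (by simp),
    ← Nat.card_congr (Sym.equivNatSumOfFintype (Fin n) m), Nat.card_eq_fintype_card,
    Sym.card_sym_eq_choose, Fintype.card_fin, show n + m - 1 = m + (n - 1) by omega,
    Nat.choose_symm_add]

theorem card_filter_lt_finAntidiagonal {n : ℕ} (hn : 2 ≤ n) (t : ℕ) (i : Fin n) :
    ((Finset.finAntidiagonal n (2 * t)).filter fun x => t < x i).card =
      (t + (n - 1) - 1).choose (n - 1) := by
  rcases t with _ | t
  · rw [Nat.choose_eq_zero_of_lt (by omega), Finset.card_eq_zero]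
    ext x
    simp +contextual
  · rw [show t + 1 + (n - 1) - 1 = t + (n - 1) by omega,
      ← card_finAntidiagonal_nat (by omega)]
    symm
    refine Finset.card_bij' (fun y _ => y + Pi.single i (t + 2)) (fun x _ => x - Pi.single i (t + 2))
      ?_ ?_ ?_ ?_
    · intro y hy
      simp only [Finset.mem_finAntidiagonal] at hy
      simp only [Finset.mem_filter, Finset.mem_finAntidiagonal, Pi.add_apply,
        Finset.sum_add_distrib, hy, Finset.sum_pi_single', Finset.mem_univ, if_true,
        Pi.single_eq_same]
      omega
    · intro x hx
      simp only [Finset.mem_filter, Finset.mem_finAntidiagonal] at hx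
      have hs : ∑ j, (x - Pi.single i (t + 2) : Fin n → ℕ) j + ∑ j, (Pi.single i (t + 2) : Fin n → ℕ) j
          = ∑ j, x j := by
        rw [← Finset.sum_add_distrib]
        refine Finset.sum_congr rfl fun j _ => ?_
        by_cases hj : j = i
        · subst hj; simp; omega
        · simp [hj]
      simp only [Finset.sum_pi_single', Finset.mem_univ, if_true] at hs
      simp only [Finset.mem_finAntidiagonal]
      omega
    · intro y _
      simp
    · intro x hx
      simp only [Finset.mem_filter, Finset.mem_finAntidiagonal] at hx
      ext j
      by_cases hj : j = i
      · subst hj; simp; omega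
      · simp [hj]

/-- The lattice points of `t • Δ_{2,n}`, with natural number coordinates. -/
def dilateLatticePoints (n t : ℕ) : Finset (Fin n → ℕ) :=
  (Finset.finAntidiagonal n (2 * t)).filter fun x => ∀ i, x i ≤ t

theorem card_dilateLatticePoints {n : ℕ} (hn : 2 ≤ n) (t : ℕ) :
    (dilateLatticePoints n t).card + n * (t + (n - 1) - 1).choose (n - 1) =
      (2 * t + (n - 1)).choose (n - 1) := by
  rw [← card_finAntidiagonal_nat (by omega) (2 * t),
    ← Finset.card_filter_add_card_filter_not (s := Finset.finAntidiagonal n (2 * t))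
      (fun x => ∀ i, x i ≤ t), dilateLatticePoints]
  congr 1
  have hU : ((Finset.finAntidiagonal n (2 * t)).filter fun x => ¬ ∀ i, x i ≤ t) =
      Finset.univ.biUnion fun i =>
        (Finset.finAntidiagonal n (2 * t)).filter fun x => t < x i := by
    ext x
    simp
  rw [hU, Finset.card_biUnion]
  · simp [card_filter_lt_finAntidiagonal hn]
  · intro i _ j _ hij
    refine Finset.disjoint_left.2 ?_
    intro x hx hy
    simp only [Finset.mem_filter, Finset.mem_finAntidiagonal] at hx hy
    have := Finset.sum_le_sum_of_subset (f := x) (Finset.subset_univ {i, j})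
    rw [Finset.sum_pair hij] at this
    omega

theorem card_filter_odd_finAntidiagonal {n : ℕ} (hn : 2 ≤ n) (t : ℕ) (S : Finset (Fin n)) :
    ((Finset.finAntidiagonal n (2 * t)).filter
      fun x => Finset.univ.filter (fun i => x i % 2 = 1) = S).card =
      if Even S.card then (t + (n - 1) - S.card / 2).choose (n - 1) else 0 := by
  have key : ∀ x : Fin n → ℕ,
      ∑ i, x i = 2 * ∑ i, x i / 2 + (Finset.univ.filter (fun i => x i % 2 = 1)).card := by
    intro x
    rw [Finset.card_filter, Finset.mul_sum, ← Finset.sum_add_distrib]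
    refine Finset.sum_congr rfl fun i _ => ?_
    split_ifs <;> omega
  by_cases hS : Even S.card ∧ S.card / 2 ≤ t
  · obtain ⟨⟨k, hk⟩, hkt⟩ := hS
    rw [if_pos ⟨k, hk⟩, show t + (n - 1) - S.card / 2 = (t - S.card / 2) + (n - 1) by omega,
      ← card_finAntidiagonal_nat (by omega)]
    refine Finset.card_bij' (fun x _ i => x i / 2) (fun y _ i => 2 * y i + if i ∈ S then 1 else 0)
      ?_ ?_ ?_ ?_
    · intro x hx
      simp only [Finset.mem_filter, Finset.mem_finAntidiagonal] at hx ⊢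
      have := key x
      rw [hx.2, hx.1] at this
      omega
    · intro y hy
      simp only [Finset.mem_filter, Finset.mem_finAntidiagonal] at hy ⊢
      constructor
      · rw [Finset.sum_add_distrib, ← Finset.mul_sum, hy]
        simp
        omega
      · ext i
        simp only [Finset.mem_filter, Finset.mem_univ, true_and]
        split_ifs with h <;> simp [h]
    · intro x hx
      simp only [Finset.mem_filter, Finset.mem_finAntidiagonal] at hx
      ext i
      simp only [← hx.2, Finset.mem_filter, Finset.mem_univ, true_and]
      split_ifs <;> omega
    · intro y _
      ext i
      dsimp only
      split_ifs <;> omega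
  · have h0 : (if Even S.card then (t + (n - 1) - S.card / 2).choose (n - 1) else 0) = 0 := by
      split_ifs with h
      · exact Nat.choose_eq_zero_of_lt (by have := not_and.1 hS h; omega)
      · rfl
    rw [h0, Finset.card_eq_zero, Finset.filter_eq_empty_iff]
    intro x hx hxS
    have := key x
    rw [hxS, Finset.mem_finAntidiagonal.1 hx] at this
    exact hS ⟨⟨t - ∑ i, x i / 2, by omega⟩, by omega⟩

theorem sum_range_two_mul (g : ℕ → ℕ) (N : ℕ) :
    ∑ m ∈ Finset.range (2 * N), g m = ∑ k ∈ Finset.range N, (g (2 * k) + g (2 * k + 1)) := by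
  induction N with
  | zero => simp
  | succ N ih =>
    rw [Nat.mul_succ, Finset.sum_range_succ, Finset.sum_range_succ, ih, Finset.sum_range_succ,
      add_assoc]

theorem choose_two_mul_add_eq_sum {n : ℕ} (hn : 2 ≤ n) (t : ℕ) :
    (2 * t + (n - 1)).choose (n - 1) =
      ∑ k ∈ Finset.range (n - 1 + 1), n.choose (2 * k) * (t + (n - 1) - k).choose (n - 1) := by
  rw [← card_finAntidiagonal_nat (by omega) (2 * t),
    Finset.card_eq_sum_card_fiberwise
      (f := fun x : Fin n → ℕ => Finset.univ.filter (fun i => x i % 2 = 1))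
      (t := (Finset.univ : Finset (Fin n)).powerset) (by intro x _; simp)]
  simp only [card_filter_odd_finAntidiagonal hn]
  rw [Finset.sum_powerset_apply_card
    (fun m => if Even m then (t + (n - 1) - m / 2).choose (n - 1) else 0), Finset.card_univ,
    Fintype.card_fin, Finset.sum_subset
      (Finset.range_subset_range.2 (show n + 1 ≤ 2 * (n - 1 + 1) by omega)), sum_range_two_mul]
  · refine Finset.sum_congr rfl fun k _ => ?_
    simp
  · intro m _ hm
    rw [Nat.choose_eq_zero_of_lt (by simpa using hm), zero_smul]

theorem hypersimplexTwo_subset (n : ℕ) :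
    hypersimplexTwo n ⊆ {x | (∀ i, 0 ≤ x i ∧ x i ≤ 1) ∧ ∑ i, x i = 2} := by
  refine convexHull_min ?_ ?_
  · rintro _ ⟨B, hB, rfl⟩
    refine ⟨fun i => ?_, ?_⟩
    · unfold indVec
      split_ifs <;> norm_num
    · simp [indVec, hB]
  · rintro x ⟨hx, hxs⟩ y ⟨hy, hys⟩ a b ha hb hab
    refine ⟨fun i => ⟨?_, ?_⟩, ?_⟩
    · have := mul_nonneg ha (hx i).1
      have := mul_nonneg hb (hy i).1
      simp only [Pi.add_apply, Pi.smul_apply, smul_eq_mul]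
      linarith
    · have := mul_le_mul_of_nonneg_left (hx i).2 ha
      have := mul_le_mul_of_nonneg_left (hy i).2 hb
      simp only [Pi.add_apply, Pi.smul_apply, smul_eq_mul]
      linarith
    · simp only [Pi.add_apply, Pi.smul_apply, smul_eq_mul, Finset.sum_add_distrib,
        ← Finset.mul_sum, hxs, hys]
      linarith

theorem cast_mem_smul_hypersimplexTwo {n : ℕ} (hn : 2 ≤ n) (t : ℕ) :
    ∀ x ∈ dilateLatticePoints n t, (fun i => (x i : ℝ)) ∈ (t : ℝ) • hypersimplexTwo n := by
  induction t with
  | zero =>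
    intro x hx
    have h0 : (fun i => (x i : ℝ)) = 0 := by
      ext i
      simp only [dilateLatticePoints, Finset.mem_filter] at hx
      simpa using hx.2 i
    obtain ⟨B, -, hB⟩ := Finset.exists_subset_card_eq
      (show 2 ≤ (Finset.univ : Finset (Fin n)).card by simpa)
    rw [h0]
    exact ⟨indVec B, subset_convexHull ℝ _ ⟨B, hB, rfl⟩, by simp⟩
  | succ t ih =>
    intro x hx
    simp only [dilateLatticePoints, Finset.mem_filter, Finset.mem_finAntidiagonal] at hx ih
    obtain ⟨hs, hle⟩ := hx
    obtain ⟨i, -, hi⟩ := Finset.exists_max_image Finset.univ x ⟨⟨0, by omega⟩, Finset.mem_univ _⟩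
    have hne : (Finset.univ.erase i).Nonempty := by
      rw [← Finset.card_pos, Finset.card_erase_of_mem (Finset.mem_univ _)]
      simp
      omega
    obtain ⟨j, hj, hj'⟩ := Finset.exists_max_image (Finset.univ.erase i) x hne
    have hij : j ≠ i := Finset.ne_of_mem_erase hj
    have hsum := Finset.add_sum_erase Finset.univ x (Finset.mem_univ i)
    have hjpos : 0 < x j := by
      by_contra h
      have : ∑ k ∈ Finset.univ.erase i, x k = 0 :=
        Finset.sum_eq_zero fun k hk => by have := hj' k hk; omega
      have := hle i
      omega
    have hipos : 0 < x i := lt_of_lt_of_le hjpos (hi j (Finset.mem_univ _))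
    have hk : ∀ k, k ≠ i → k ≠ j → x k ≤ t := by
      intro k hki hkj
      have h1 := Finset.sum_le_sum_of_subset (f := x) (Finset.subset_univ {k, i, j})
      rw [Finset.sum_insert (by simp [hki, hkj]), Finset.sum_pair hij.symm] at h1
      have := hi k (Finset.mem_univ _)
      have := hj' k (Finset.mem_erase.2 ⟨hki, Finset.mem_univ _⟩)
      omega
    have hB : ({i, j} : Finset (Fin n)).card = 2 := Finset.card_pair hij.symm
    let e : Fin n → ℕ := fun k => if k ∈ ({i, j} : Finset (Fin n)) then 1 else 0
    have hex : ∀ k, e k ≤ x k := by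
      intro k
      simp only [e, Finset.mem_insert, Finset.mem_singleton]
      split_ifs with h
      · rcases h with rfl | rfl <;> omega
      · omega
    have hes : ∑ k, e k = 2 := by simp only [e, Finset.sum_ite_mem, Finset.univ_inter, ← Finset.card_eq_sum_ones, hB]
    have hmem := ih (fun k => x k - e k) ⟨?_, ?_⟩
    · rw [Nat.cast_succ, Convex.add_smul (s := hypersimplexTwo n) (convex_convexHull ℝ _) (Nat.cast_nonneg t) zero_le_one,
        one_smul]
      refine ⟨_, hmem, indVec {i, j}, subset_convexHull ℝ _ ⟨_, hB, rfl⟩, ?_⟩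
      ext k
      have he : indVec {i, j} k = (e k : ℝ) := by simp [indVec, e]
      simp only [Pi.add_apply, he, Nat.cast_sub (hex k)]
      ring
    · have : ∑ k, (x k - e k) + ∑ k, e k = ∑ k, x k := by
        rw [← Finset.sum_add_distrib]
        exact Finset.sum_congr rfl fun k _ => Nat.sub_add_cancel (hex k)
      omega
    · intro k
      have := hle k
      by_cases h : k = i ∨ k = j
      · simp [e, h]
        omega
      · push Not at h
        exact (Nat.sub_le _ _).trans (hk k h.1 h.2)

theorem latticeCount_smul_hypersimplexTwo {n : ℕ} (hn : 2 ≤ n) (t : ℕ) :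
    latticeCount ((t : ℝ) • hypersimplexTwo n) = (dilateLatticePoints n t).card := by
  have himg : {x ∈ (t : ℝ) • hypersimplexTwo n | ∀ i, ∃ m : ℤ, x i = (m : ℝ)} =
      (fun (x : Fin n → ℕ) i => (x i : ℝ)) '' (dilateLatticePoints n t : Set (Fin n → ℕ)) := by
    ext x
    constructor
    · rintro ⟨⟨y, hy, rfl⟩, hint⟩
      obtain ⟨hy, hys⟩ := hypersimplexTwo_subset n hy
      choose m hm using hint
      simp only [Pi.smul_apply, smul_eq_mul] at hm
      have hm0 : ∀ i, 0 ≤ m i := fun i => by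
        have := mul_nonneg (Nat.cast_nonneg (α := ℝ) t) (hy i).1
        rw [hm] at this
        exact_mod_cast this
      lift m to Fin n → ℕ using hm0
      simp only [Int.cast_natCast] at hm
      refine ⟨m, ?_, ?_⟩
      · simp only [dilateLatticePoints, Finset.coe_filter, Finset.mem_finAntidiagonal,
          Set.mem_ofPred_eq]
        constructor
        · have : ∑ i, (m i : ℝ) = 2 * t := by
            simp only [← hm, ← Finset.mul_sum, hys]
            ring
          exact_mod_cast this
        · intro i
          have := mul_le_mul_of_nonneg_left (hy i).2 (Nat.cast_nonneg (α := ℝ) t)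
          rw [hm, mul_one] at this
          exact_mod_cast this
      · ext i
        simp [hm]
    · rintro ⟨y, hy, rfl⟩
      exact ⟨cast_mem_smul_hypersimplexTwo hn t y hy, fun i => ⟨y i, by simp⟩⟩
  rw [latticeCount, himg, Set.ncard_image_of_injective, Set.ncard_coe_finset]
  intro x y hxy
  ext i
  simpa using congrFun hxy i

theorem eq_of_sum_mul_choose_eq {d : ℕ} {a b : ℕ → ℤ}
    (hab : ∀ t : ℕ, ∑ k ∈ Finset.range (d + 1), a k * ((t + d - k).choose d : ℤ) =
      ∑ k ∈ Finset.range (d + 1), b k * ((t + d - k).choose d : ℤ)) :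
    ∀ k ≤ d, a k = b k := by
  intro t
  induction t using Nat.strong_induction_on with
  | _ t ih =>
    intro ht
    have h := hab t
    rw [← sub_eq_zero, ← Finset.sum_sub_distrib, Finset.sum_eq_single t] at h
    · simpa [sub_eq_zero] using h
    · intro k hk hkt
      rcases lt_or_gt_of_ne hkt with hlt | hgt
      · rw [ih k hlt (by omega), sub_self]
      · rw [Nat.choose_eq_zero_of_lt (by rw [Finset.mem_range] at hk; omega)]
        simp
    · intro h'
      exact absurd (Finset.mem_range.2 (by omega)) h'

/-- The `h*`-vector of the hypersimplex `Δ_{2,n}` is given by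
`h*₀ = 1`, `h*₁ = C(n,2) - n`, and `h*_k = C(n, 2k)` for every `k ≥ 2`. -/
theorem hstar_hypersimplex_two_explicit (n : ℕ) (hn : 2 ≤ n) (h : ℕ → ℕ)
    (hh : IsHStarVector (hypersimplexTwo n) (n - 1) h) :
    h 0 = 1 ∧ h 1 = n.choose 2 - n ∧ ∀ k : ℕ, 2 ≤ k → h k = n.choose (2 * k) := by
  obtain ⟨hsum, hzero⟩ := hh
  have key := eq_of_sum_mul_choose_eq (d := n - 1) (a := fun k => (h k : ℤ))
    (b := fun k => (n.choose (2 * k) : ℤ) - if k = 1 then (n : ℤ) else 0) (by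
      intro t
      have h1 := hsum t
      have h2 := card_dilateLatticePoints hn t
      rw [← latticeCount_smul_hypersimplexTwo hn, choose_two_mul_add_eq_sum hn, h1] at h2
      zify at h2
      simp only [sub_mul, Finset.sum_sub_distrib, ite_mul, zero_mul, Finset.sum_ite_eq']
      rw [if_pos (Finset.mem_range.2 (by omega))]
      linarith)
  refine ⟨?_, ?_, fun k hk => ?_⟩
  · have := key 0 (by omega)
    simpa using this
  · have := key 1 (by omega)
    simp only [mul_one, if_true] at this
    omega
  · by_cases hkd : k ≤ n - 1
    · have := key k hkd
      rw [if_neg (by omega), sub_zero] at this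
      exact_mod_cast this
    · rw [hzero k (by omega), Nat.choose_eq_zero_of_lt (by omega)]
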